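/- arXiv:1603.05639 — 2 statements merged into one kernel-verified Lean document; each statement's English description precedes it below -/
import Mathlib

section
/- There exists a positive constant c2 such that for every connected Eulerian digraph G on n vertices and m directed edges and every a>0, the lazy simple random walk on G satisfies t_unif(a) ≤ (c2/a)·min(m·n, m²/a). -/
open Finset

/-- The out-degree of a vertex in a digraph. -/
def dout {V : Type} [Fintype V] (E : V → V → Prop) [DecidableRel E] (x : V) : ℕ :=
  (Finset.univ.filter fun y => E x y).card

/-- The in-degree of a vertex in a digraph. -/
def din {V : Type} [Fintype V] (E : V → V → Prop) [DecidableRel E] (x : V) : ℕ :=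
  (Finset.univ.filter fun y => E y x).card

/-- The number of directed edges of a digraph. -/
def numEdges {V : Type} [Fintype V] (E : V → V → Prop) [DecidableRel E] : ℕ :=
  ∑ x, dout E x

/-- The transition matrix of the lazy simple random walk on a digraph. -/
noncomputable def lazyP {V : Type} [Fintype V] [DecidableEq V] (E : V → V → Prop)
    [DecidableRel E] : Matrix V V ℝ :=
  fun v w => if v = w then 1 / 2 else if E v w then 1 / (2 * (dout E v : ℝ)) else 0

/-- The stationary distribution `π(v) = d_out(v)/m` of the lazy walk on an Eulerian digraph. -/
noncomputable def statDist {V : Type} [Fintype V] (E : V → V → Prop) [DecidableRel E]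
    (v : V) : ℝ :=
  (dout E v : ℝ) / (numEdges E : ℝ)

section LazyWalk

variable {V : Type} [Fintype V] (E : V → V → Prop) [DecidableRel E]

/-- The sum of the squared increments of `f` over the directed edges. -/
noncomputable def edgeEnergy (f : V → ℝ) : ℝ :=
  ∑ z, ∑ w, if E z w then (f z - f w) ^ 2 else 0

lemma edgeEnergy_nonneg (f : V → ℝ) : 0 ≤ edgeEnergy E f :=
  sum_nonneg fun z _ => sum_nonneg fun w _ => by split_ifs <;> positivity

lemma sum_out_const (z : V) (c : ℝ) : (∑ w, if E z w then c else 0) = dout E z * c := by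
  rw [← sum_filter, sum_const, nsmul_eq_mul, dout]

lemma sum_in_const (w : V) (c : ℝ) : (∑ z, if E z w then c else 0) = din E w * c := by
  rw [← sum_filter, sum_const, nsmul_eq_mul, din]

/-- One step of lazy averaging over in-neighbours lowers the weighted `ℓ²` norm by at least a
quarter of the edge energy. -/
lemma sum_lazy_average_sq_le (hE : ∀ x, dout E x = din E x) (hpos : ∀ x, 0 < dout E x)
    (f g : V → ℝ)
    (hg : ∀ w, g w = f w / 2 + (∑ z, if E z w then f z else 0) / (2 * dout E w)) :
    ∑ w, (dout E w : ℝ) * g w ^ 2 ≤ ∑ w, (dout E w : ℝ) * f w ^ 2 - edgeEnergy E f / 4 := by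
  have jensen : ∀ w, (dout E w : ℝ) * g w ^ 2 ≤
      ∑ z, if E z w then ((f w + f z) / 2) ^ 2 else 0 := by
    intro w
    have hd : (0 : ℝ) < dout E w := by exact_mod_cast hpos w
    have hcard : ((univ.filter fun z => E z w).card : ℝ) = dout E w := by
      rw [hE w]; rfl
    have hs : (dout E w : ℝ) * g w = ∑ z ∈ univ.filter (fun z => E z w), (f w + f z) / 2 := by
      rw [← sum_div, sum_add_distrib, sum_const, nsmul_eq_mul, hcard, hg w, sum_filter]
      field_simp
    have hcs := sq_sum_le_card_mul_sum_sq (s := univ.filter (fun z => E z w))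
      (f := fun z => (f w + f z) / 2)
    rw [← hs, hcard] at hcs
    rw [← sum_filter]
    refine le_of_mul_le_mul_left ?_ hd
    calc (dout E w : ℝ) * (dout E w * g w ^ 2) = (dout E w * g w) ^ 2 := by ring
      _ ≤ _ := hcs
  have hexpand : ∀ w z, (if E z w then ((f w + f z) / 2) ^ 2 else 0) =
      (if E z w then f w ^ 2 / 2 else 0) + (if E z w then f z ^ 2 / 2 else 0)
        - (if E z w then (f z - f w) ^ 2 else 0) / 4 := by
    intro w z
    split_ifs <;> ring
  refine (sum_le_sum fun w _ => jensen w).trans (le_of_eq ?_)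
  simp_rw [hexpand, sum_sub_distrib, sum_add_distrib]
  have hin : (∑ w, ∑ z, if E z w then f w ^ 2 / 2 else 0)
      = (∑ w, (dout E w : ℝ) * f w ^ 2) / 2 := by
    rw [sum_div]
    exact sum_congr rfl fun w _ => by rw [sum_in_const, hE w]; ring
  have hout : (∑ w, ∑ z, if E z w then f z ^ 2 / 2 else 0)
      = (∑ w, (dout E w : ℝ) * f w ^ 2) / 2 := by
    rw [sum_comm, sum_div]
    exact sum_congr rfl fun w _ => by rw [sum_out_const]; ring
  have henergy : (∑ w, ∑ z, (if E z w then (f z - f w) ^ 2 else 0) / 4)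
      = edgeEnergy E f / 4 := by
    rw [sum_comm, edgeEnergy, sum_div]
    exact sum_congr rfl fun z _ => by rw [sum_div]
  rw [hin, hout, henergy]
  ring

/-- Going from `x` to the sublevel set `{f ≤ θ}` along a shortest path bounds the drop of `f` by
the edge energy and the length `L` of the path. -/
lemma exists_length_sq_le_edgeEnergy (hconn : (SimpleGraph.fromRel E).Connected) (f : V → ℝ)
    (θ : ℝ) (x : V) (hx : θ ≤ f x) (hlow : ∃ y, f y ≤ θ) :
    ∃ L : ℕ, L ≤ (univ.filter fun z => θ < f z).card ∧
      (f x - θ) ^ 2 ≤ 2 * L * edgeEnergy E f := by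
  classical
  set G := SimpleGraph.fromRel E
  obtain ⟨y, hy, hmin⟩ := exists_min_image (univ.filter fun y => f y ≤ θ) (fun y => G.dist x y)
    (by obtain ⟨y, hy⟩ := hlow; exact ⟨y, by simpa using hy⟩)
  simp only [mem_filter, mem_univ, true_and] at hy hmin
  obtain ⟨p, hp⟩ := hconn.exists_walk_length_eq_dist x y
  have hpath : p.IsPath := p.isPath_of_length_eq_dist hp
  have hinj : Set.InjOn p.getVert (range p.length : Set ℕ) := by
    intro i hi j hj hij
    simp only [coe_range, Set.mem_Iio] at hi hj
    exact hpath.getVert_injOn hi.le hj.le hij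
  refine ⟨p.length, ?_, ?_⟩
  · rw [← card_range p.length, ← card_image_of_injOn hinj]
    refine card_le_card fun z hz => ?_
    obtain ⟨i, hi, rfl⟩ := mem_image.1 hz
    rw [mem_range] at hi
    rw [mem_filter]
    refine ⟨mem_univ _, not_le.1 fun h => ?_⟩
    have h1 := hmin _ h
    have h2 : G.dist x (p.getVert i) ≤ (p.take i).length := SimpleGraph.dist_le _
    rw [SimpleGraph.Walk.take_length] at h2
    omega
  · have htel : ∑ i ∈ range p.length, (f (p.getVert i) - f (p.getVert (i + 1))) = f x - f y := by
      rw [sum_range_sub' (fun i => f (p.getVert i))]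
      simp
    have hcs := sq_sum_le_card_mul_sum_sq (s := range p.length)
      (f := fun i => f (p.getVert i) - f (p.getVert (i + 1)))
    rw [htel, card_range] at hcs
    let R : V → V → ℝ := fun z w =>
      (if E z w then (f z - f w) ^ 2 else 0) + (if E w z then (f w - f z) ^ 2 else 0)
    have hR : ∀ z w, 0 ≤ R z w := fun z w => by
      simp only [R]; split_ifs <;> positivity
    have hstep : ∀ i ∈ range p.length,
        (f (p.getVert i) - f (p.getVert (i + 1))) ^ 2 ≤ ∑ w, R (p.getVert i) w := by
      intro i hi
      refine le_trans ?_ (single_le_sum (fun w _ => hR _ w) (mem_univ (p.getVert (i + 1))))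
      have hadj := p.adj_getVert_succ (mem_range.1 hi)
      rw [SimpleGraph.fromRel_adj] at hadj
      simp only [R]
      rcases hadj.2 with h | h
      · rw [if_pos h]
        split_ifs <;> nlinarith [sq_nonneg (f (p.getVert (i + 1)) - f (p.getVert i))]
      · rw [if_pos h]
        split_ifs <;> nlinarith [sq_nonneg (f (p.getVert (i + 1)) - f (p.getVert i))]
    have htotal : ∑ z, ∑ w, R z w = 2 * edgeEnergy E f := by
      simp only [R, sum_add_distrib]
      rw [two_mul]
      congr 1
      rw [sum_comm]
      rfl
    have hsum : ∑ i ∈ range p.length, (f (p.getVert i) - f (p.getVert (i + 1))) ^ 2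
        ≤ 2 * edgeEnergy E f := by
      rw [← htotal]
      refine (sum_le_sum hstep).trans ?_
      rw [← sum_image (f := fun z => ∑ w, R z w) hinj]
      exact sum_le_sum_of_subset_of_nonneg (subset_univ _)
        fun z _ _ => sum_nonneg fun w _ => hR z w
    calc (f x - θ) ^ 2 ≤ (f x - f y) ^ 2 := by
          apply pow_le_pow_left₀ <;> linarith
      _ ≤ _ := hcs
      _ ≤ p.length * (2 * edgeEnergy E f) := by gcongr
      _ = _ := by ring

lemma statDist_pos (hm : 0 < numEdges E) (hpos : ∀ x, 0 < dout E x) (z : V) :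
    0 < statDist E z :=
  div_pos (by exact_mod_cast hpos z) (by exact_mod_cast hm)

lemma sum_statDist (hm : 0 < numEdges E) : ∑ z, statDist E z = 1 := by
  have hm' : (numEdges E : ℝ) ≠ 0 := by exact_mod_cast hm.ne'
  simp only [statDist]
  rw [← sum_div, div_eq_one_iff_eq hm', numEdges]
  push_cast
  rfl

/-- Nash-type inequalities for the edge energy of a probability density. -/
lemma edgeEnergy_nash (hconn : (SimpleGraph.fromRel E).Connected) (hm : 0 < numEdges E)
    (hpos : ∀ x, 0 < dout E x) (f : V → ℝ) (hf : ∀ z, 0 ≤ f z)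
    (hf1 : ∑ z, statDist E z * f z = 1) (v : ℝ) (hv : v = ∑ z, statDist E z * (f z - 1) ^ 2) :
    v ^ 2 ≤ 8 * Fintype.card V * edgeEnergy E f ∧ v ^ 3 ≤ 16 * numEdges E * edgeEnergy E f := by
  classical
  have hπ := statDist_pos E hm hpos
  have hπ1 := sum_statDist E hm
  have hmR : (0 : ℝ) < numEdges E := by exact_mod_cast hm
  have hD := edgeEnergy_nonneg E f
  have hv0 : 0 ≤ v := hv ▸ sum_nonneg fun z _ => mul_nonneg (hπ z).le (sq_nonneg _)
  have : Nonempty V := hconn.nonempty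
  obtain ⟨x, -, hx⟩ := exists_max_image univ f univ_nonempty
  have hvx : v ≤ f x - 1 := by
    have h1 : v = ∑ z, statDist E z * f z * (f z - 1) := by
      have : ∀ z, statDist E z * (f z - 1) ^ 2
          = statDist E z * f z * (f z - 1) - statDist E z * f z + statDist E z :=
        fun z => by ring
      rw [hv, sum_congr rfl fun z _ => this z, sum_add_distrib, sum_sub_distrib, hf1, hπ1]
      ring
    rw [h1]
    calc ∑ z, statDist E z * f z * (f z - 1) ≤ ∑ z, statDist E z * f z * (f x - 1) :=
          sum_le_sum fun z hz => mul_le_mul_of_nonneg_left (by linarith [hx z hz])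
            (mul_nonneg (hπ z).le (hf z))
      _ = f x - 1 := by rw [← sum_mul, hf1, one_mul]
  have hlow : ∃ y, f y ≤ 1 := by
    by_contra! h
    have : ∑ z, statDist E z < ∑ z, statDist E z * f z :=
      sum_lt_sum_of_nonempty univ_nonempty fun z _ => by nlinarith [hπ z, h z]
    linarith
  set θ := (1 + f x) / 2 with hθ
  obtain ⟨L, hL, hsq⟩ := exists_length_sq_le_edgeEnergy E hconn f θ x (by linarith)
    (hlow.imp fun y hy => by linarith)
  have hLn : (L : ℝ) ≤ Fintype.card V := by
    exact_mod_cast hL.trans (card_le_univ _)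
  have hLm : (L : ℝ) * θ ≤ numEdges E := by
    calc (L : ℝ) * θ ≤ (univ.filter fun z => θ < f z).card * θ := by
          have : (0 : ℝ) ≤ θ := by linarith
          gcongr
      _ = ∑ z ∈ univ.filter (fun z => θ < f z), θ := by rw [sum_const, nsmul_eq_mul]
      _ ≤ ∑ z ∈ univ.filter (fun z => θ < f z), (numEdges E : ℝ) * (statDist E z * f z) := by
          refine sum_le_sum fun z hz => ?_
          have h1 : (1 : ℝ) ≤ dout E z := by exact_mod_cast hpos z
          have h2 : (numEdges E : ℝ) * (statDist E z * f z) = dout E z * f z := by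
            rw [statDist]; field_simp
          have h3 := (mem_filter.1 hz).2
          rw [h2]
          nlinarith [hf z]
      _ ≤ ∑ z, (numEdges E : ℝ) * (statDist E z * f z) :=
          sum_le_sum_of_subset_of_nonneg (filter_subset _ _) fun z _ _ =>
            mul_nonneg hmR.le (mul_nonneg (hπ z).le (hf z))
      _ = numEdges E := by rw [← mul_sum, hf1, mul_one]
  have hdrop : v ^ 2 ≤ 8 * (L * edgeEnergy E f) := by
    have : (v / 2) ^ 2 ≤ (f x - θ) ^ 2 := by
      apply pow_le_pow_left₀ <;> linarith
    linarith
  constructor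
  · have : (L : ℝ) * edgeEnergy E f ≤ Fintype.card V * edgeEnergy E f := by gcongr
    linarith
  · have hvθ : v ≤ 2 * θ := by linarith
    calc v ^ 3 = v ^ 2 * v := by ring
      _ ≤ 8 * (L * edgeEnergy E f) * (2 * θ) := by gcongr
      _ = 16 * (L * θ) * edgeEnergy E f := by ring
      _ ≤ _ := by gcongr

lemma dout_swap (hE : ∀ x, dout E x = din E x) (x : V) :
    dout (fun x y => E y x) x = dout E x := (hE x).symm

lemma numEdges_swap (hE : ∀ x, dout E x = din E x) :
    numEdges (fun x y => E y x) = numEdges E :=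
  sum_congr rfl fun x _ => dout_swap E hE x

lemma statDist_swap (hE : ∀ x, dout E x = din E x) (x : V) :
    statDist (fun x y => E y x) x = statDist E x := by
  rw [statDist, dout_swap E hE, numEdges_swap E hE, statDist]

lemma dout_pos_of_connected (hE : ∀ x, dout E x = din E x)
    (hconn : (SimpleGraph.fromRel E).Connected) (hl : ∀ x, ¬ E x x) (hm : 0 < numEdges E)
    (x : V) : 0 < dout E x := by
  obtain ⟨z, -, hz⟩ := exists_ne_zero_of_sum_ne_zero hm.ne'
  obtain ⟨w, hw⟩ := card_pos.1 (Nat.pos_of_ne_zero hz)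
  have hzw : z ≠ w := fun h => hl z (by simpa [← h] using hw)
  have : Nontrivial V := ⟨z, w, hzw⟩
  obtain ⟨y, hy⟩ := hconn.preconnected.exists_adj_of_nontrivial x
  rcases ((SimpleGraph.fromRel_adj _ _ _).1 hy).2 with h | h
  · exact card_pos.2 ⟨y, by simpa using h⟩
  · rw [hE x]
    exact card_pos.2 ⟨y, by simpa using h⟩

end LazyWalk

lemma natCast_mul_le_of_quadratic_decay {v : ℕ → ℝ} {K : ℝ} (hK : 0 < K) (hv : ∀ t, 0 ≤ v t)
    (hstep : ∀ t, v (t + 1) ≤ v t - v t ^ 2 / K) (t : ℕ) : t * v t ≤ K := by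
  induction t with
  | zero => simpa using hK.le
  | succ t ih =>
    have hs : v t ^ 2 / K ≤ v t := by linarith [hstep t, hv (t + 1)]
    have hsK : v t ≤ K := by
      rw [div_le_iff₀ hK] at hs
      rcases (hv t).eq_or_lt with h | h
      · linarith
      · nlinarith
    have h1 : 0 ≤ 1 - v t / K := by
      rw [sub_nonneg, div_le_one hK]; exact hsK
    have hstep' : v (t + 1) ≤ v t * (1 - v t / K) := by
      have := hstep t
      have e : v t * (1 - v t / K) = v t - v t ^ 2 / K := by ring
      linarith
    push_cast
    calc ((t : ℝ) + 1) * v (t + 1) ≤ (t + 1) * (v t * (1 - v t / K)) := by gcongr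
      _ = (t * v t + v t) * (1 - v t / K) := by ring
      _ ≤ (K + v t) * (1 - v t / K) := by gcongr
      _ = K - v t ^ 2 / K := by field_simp; ring
      _ ≤ K := by linarith [div_nonneg (sq_nonneg (v t)) hK.le]

lemma natCast_mul_sq_le_of_cubic_decay {v : ℕ → ℝ} {K : ℝ} (hK : 0 < K) (hv : ∀ t, 0 ≤ v t)
    (hstep : ∀ t, v (t + 1) ≤ v t - v t ^ 3 / K) (t : ℕ) : t * v t ^ 2 ≤ K := by
  refine natCast_mul_le_of_quadratic_decay (v := fun t => v t ^ 2) hK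
    (fun t => sq_nonneg _) (fun t => ?_) t
  have h3 : 0 ≤ v t ^ 3 / K := div_nonneg (pow_nonneg (hv t) 3) hK.le
  calc v (t + 1) ^ 2 = v (t + 1) * v (t + 1) := sq _
    _ ≤ v t * (v t - v t ^ 3 / K) :=
        mul_le_mul (by linarith [hstep t]) (hstep t) (hv _) (hv _)
    _ = v t ^ 2 - (v t ^ 2) ^ 2 / K := by ring

section Density

variable {V : Type} [Fintype V] [DecidableEq V] (E : V → V → Prop) [DecidableRel E]

/-- The density of the time-`t` law of the walk from `x` with respect to `statDist E`. -/
noncomputable def walkDensity (x : V) (t : ℕ) (z : V) : ℝ :=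
  (lazyP E ^ t) x z / statDist E z

/-- The squared `L²(π)` distance of the time-`t` density from `1`. -/
noncomputable def chiSq (x : V) (t : ℕ) : ℝ :=
  ∑ z, statDist E z * (walkDensity E x t z - 1) ^ 2

lemma lazyP_eq_add (hl : ∀ x, ¬ E x x) (v w : V) :
    lazyP E v w = (if v = w then 1 / 2 else 0) + if E v w then 1 / (2 * (dout E v : ℝ)) else 0 := by
  unfold lazyP
  by_cases h : v = w
  · subst h; simp [hl]
  · simp [h]

lemma lazyP_pow_nonneg (t : ℕ) (x z : V) : 0 ≤ (lazyP E ^ t) x z := by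
  induction t generalizing z with
  | zero => rw [pow_zero, Matrix.one_apply]; split_ifs <;> norm_num
  | succ t ih =>
    rw [pow_succ, Matrix.mul_apply]
    refine sum_nonneg fun y _ => mul_nonneg (ih y) ?_
    unfold lazyP
    split_ifs <;> positivity

lemma sum_lazyP_pow (hl : ∀ x, ¬ E x x) (hpos : ∀ x, 0 < dout E x) (t : ℕ) (x : V) :
    ∑ z, (lazyP E ^ t) x z = 1 := by
  induction t with
  | zero => simp [Matrix.one_apply]
  | succ t ih =>
    have hrow : ∀ y, ∑ z, lazyP E y z = 1 := by
      intro y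
      have hd : (dout E y : ℝ) ≠ 0 := by exact_mod_cast (hpos y).ne'
      simp_rw [lazyP_eq_add E hl, sum_add_distrib, sum_out_const E, sum_ite_eq, mem_univ, if_true]
      field_simp
      norm_num
    simp_rw [pow_succ, Matrix.mul_apply]
    rw [sum_comm, ← ih]
    exact sum_congr rfl fun y _ => by rw [← mul_sum, hrow, mul_one]

lemma sum_statDist_mul_walkDensity (hl : ∀ x, ¬ E x x) (hm : 0 < numEdges E)
    (hpos : ∀ x, 0 < dout E x) (t : ℕ) (x : V) :
    ∑ z, statDist E z * walkDensity E x t z = 1 := by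
  rw [← sum_lazyP_pow E hl hpos t x]
  exact sum_congr rfl fun z _ => mul_div_cancel₀ _ (statDist_pos E hm hpos z).ne'

lemma walkDensity_succ (hl : ∀ x, ¬ E x x) (hm : 0 < numEdges E) (hpos : ∀ x, 0 < dout E x)
    (x : V) (t : ℕ) (w : V) :
    walkDensity E x (t + 1) w = walkDensity E x t w / 2
      + (∑ z, if E z w then walkDensity E x t z else 0) / (2 * dout E w) := by
  have hd : ∀ z, (dout E z : ℝ) ≠ 0 := fun z => by exact_mod_cast (hpos z).ne'
  have hm' : (numEdges E : ℝ) ≠ 0 := by exact_mod_cast hm.ne'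
  unfold walkDensity
  rw [pow_succ, Matrix.mul_apply]
  simp_rw [lazyP_eq_add E hl, mul_add, sum_add_distrib, add_div]
  congr 1
  · simp
    ring
  · rw [sum_div, sum_div]
    refine sum_congr rfl fun z _ => ?_
    have := hd z
    have := hd w
    split_ifs
    · unfold statDist; field_simp
    · simp

lemma chiSq_nonneg (hm : 0 < numEdges E) (hpos : ∀ x, 0 < dout E x) (x : V) (t : ℕ) :
    0 ≤ chiSq E x t :=
  sum_nonneg fun z _ => mul_nonneg (statDist_pos E hm hpos z).le (sq_nonneg _)

lemma chiSq_succ_le (hl : ∀ x, ¬ E x x) (hE : ∀ x, dout E x = din E x) (hm : 0 < numEdges E)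
    (hpos : ∀ x, 0 < dout E x) (x : V) (t : ℕ) :
    chiSq E x (t + 1) ≤
      chiSq E x t - edgeEnergy E (walkDensity E x t) / (4 * numEdges E) := by
  have hmR : (0 : ℝ) < numEdges E := by exact_mod_cast hm
  have hchi : ∀ s, chiSq E x s
      = (∑ z, (dout E z : ℝ) * (walkDensity E x s z - 1) ^ 2) / numEdges E := by
    intro s
    rw [chiSq, sum_div]
    exact sum_congr rfl fun z _ => by rw [statDist]; ring
  have henergy : edgeEnergy E (fun z => walkDensity E x t z - 1)
      = edgeEnergy E (walkDensity E x t) := by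
    simp [edgeEnergy]
  have key := sum_lazy_average_sq_le E hE hpos (fun z => walkDensity E x t z - 1)
    (fun z => walkDensity E x (t + 1) z - 1) (fun w => by
      have hd : (dout E w : ℝ) ≠ 0 := by exact_mod_cast (hpos w).ne'
      have hsplit : (∑ z, if E z w then walkDensity E x t z - 1 else 0)
          = (∑ z, if E z w then walkDensity E x t z else 0) - dout E w := by
        have h1 := sum_in_const E w 1
        rw [mul_one, ← hE w] at h1
        rw [← h1, ← sum_sub_distrib]
        exact sum_congr rfl fun z _ => by split_ifs <;> ring
      rw [hsplit, walkDensity_succ E hl hm hpos]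
      field_simp
      ring)
  rw [henergy] at key
  rw [hchi, hchi, show edgeEnergy E (walkDensity E x t) / (4 * numEdges E)
    = edgeEnergy E (walkDensity E x t) / 4 / numEdges E by field_simp, ← sub_div]
  gcongr

lemma chiSq_decay (hl : ∀ x, ¬ E x x) (hE : ∀ x, dout E x = din E x)
    (hconn : (SimpleGraph.fromRel E).Connected) (hm : 0 < numEdges E)
    (hpos : ∀ x, 0 < dout E x) (x : V) (t : ℕ) :
    t * chiSq E x t ≤ 32 * (numEdges E * Fintype.card V) ∧
      t * chiSq E x t ^ 2 ≤ 64 * numEdges E ^ 2 := by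
  have hmR : (0 : ℝ) < numEdges E := by exact_mod_cast hm
  have : Nonempty V := hconn.nonempty
  have hn : (0 : ℝ) < Fintype.card V := by exact_mod_cast Fintype.card_pos
  have hnash := fun t => edgeEnergy_nash E hconn hm hpos (walkDensity E x t)
    (fun z => div_nonneg (lazyP_pow_nonneg E t x z) (statDist_pos E hm hpos z).le)
    (sum_statDist_mul_walkDensity E hl hm hpos t x) _ rfl
  constructor
  · refine natCast_mul_le_of_quadratic_decay (by positivity) (chiSq_nonneg E hm hpos x)
      (fun t => (chiSq_succ_le E hl hE hm hpos x t).trans (sub_le_sub_left ?_ _)) t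
    rw [div_le_div_iff₀ (by positivity) (by positivity)]
    have h : chiSq E x t ^ 2 ≤ _ := (hnash t).1
    nlinarith
  · refine natCast_mul_sq_le_of_cubic_decay (by positivity) (chiSq_nonneg E hm hpos x)
      (fun t => (chiSq_succ_le E hl hE hm hpos x t).trans (sub_le_sub_left ?_ _)) t
    rw [div_le_div_iff₀ (by positivity) (by positivity)]
    have h : chiSq E x t ^ 3 ≤ _ := (hnash t).2
    nlinarith

lemma chiSq_zero_le (hm : 0 < numEdges E) (hpos : ∀ x, 0 < dout E x) (x : V) :
    chiSq E x 0 ≤ numEdges E := by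
  have hmR : (0 : ℝ) < numEdges E := by exact_mod_cast hm
  have hterm : ∀ z, statDist E z * (walkDensity E x 0 z - 1) ^ 2
      = statDist E z + if x = z then (statDist E z)⁻¹ - 2 else 0 := by
    intro z
    have := (statDist_pos E hm hpos z).ne'
    rw [walkDensity, pow_zero, Matrix.one_apply]
    split_ifs
    · field_simp
      ring
    · simp
  have hinv : (statDist E x)⁻¹ ≤ numEdges E := by
    rw [statDist, inv_div]
    exact div_le_self hmR.le (by exact_mod_cast hpos x)
  rw [chiSq, sum_congr rfl fun z _ => hterm z, sum_add_distrib, sum_statDist E hm]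
  simp only [sum_ite_eq, mem_univ, if_true]
  linarith

end Density

section Reversal

variable {V : Type} [Fintype V] [DecidableEq V] (E : V → V → Prop) [DecidableRel E]

lemma statDist_mul_lazyP_pow_swap (hE : ∀ x, dout E x = din E x) (hpos : ∀ x, 0 < dout E x)
    (t : ℕ) (y z : V) :
    statDist E y * (lazyP (fun x y => E y x) ^ t) y z = statDist E z * (lazyP E ^ t) z y := by
  induction t generalizing z with
  | zero =>
    rw [pow_zero, pow_zero, Matrix.one_apply, Matrix.one_apply]
    by_cases h : y = z
    · simp [h]
    · simp [h, Ne.symm h]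
  | succ t ih =>
    have hone : ∀ w, lazyP (fun x y => E y x) w z * statDist E w = statDist E z * lazyP E z w := by
      intro w
      have hz : (dout E z : ℝ) ≠ 0 := by exact_mod_cast (hpos z).ne'
      have hw : (dout E w : ℝ) ≠ 0 := by exact_mod_cast (hpos w).ne'
      by_cases h : w = z
      · subst h; simp [lazyP, mul_comm]
      · simp only [lazyP, h, Ne.symm h, if_false, dout_swap E hE]
        split_ifs
        · unfold statDist; field_simp
        · simp
    rw [pow_succ, pow_succ', Matrix.mul_apply, Matrix.mul_apply, mul_sum, mul_sum]
    refine sum_congr rfl fun w _ => ?_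
    rw [← mul_assoc, ih, ← mul_assoc, ← hone w]
    ring

/-- Cauchy–Schwarz at the midpoint: the forward and reversed `L²` distances at time `t` control
the uniform distance at time `2t`. -/
lemma sq_lazyP_pow_two_mul_le (hl : ∀ x, ¬ E x x) (hE : ∀ x, dout E x = din E x)
    (hm : 0 < numEdges E) (hpos : ∀ x, 0 < dout E x) (t : ℕ) (x y : V) :
    ((lazyP E ^ (2 * t)) x y / statDist E y - 1) ^ 2
      ≤ chiSq E x t * chiSq (fun x y => E y x) y t := by
  have hπ := statDist_pos E hm hpos
  have hF := sum_statDist_mul_walkDensity E hl hm hpos t x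
  have hrev := sum_statDist_mul_walkDensity (fun x y => E y x) (fun x => hl x)
    (by rw [numEdges_swap E hE]; exact hm) (fun x => by rw [dout_swap E hE]; exact hpos x) t y
  simp only [statDist_swap E hE] at hrev
  set F := walkDensity E x t with hFdef
  set H := walkDensity (fun x y => E y x) y t with hHdef
  have hprod : (lazyP E ^ (2 * t)) x y / statDist E y = ∑ z, statDist E z * (F z * H z) := by
    rw [two_mul, pow_add, Matrix.mul_apply, sum_div]
    refine sum_congr rfl fun z _ => ?_
    have h1 := statDist_mul_lazyP_pow_swap E hE hpos t y z
    have hz := (hπ z).ne'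
    have hy := (hπ y).ne'
    rw [hFdef, hHdef, walkDensity, walkDensity, statDist_swap E hE]
    field_simp
    linear_combination (-(lazyP E ^ t) x z) * h1
  have hcenter : (lazyP E ^ (2 * t)) x y / statDist E y - 1
      = ∑ z, statDist E z * ((F z - 1) * (H z - 1)) := by
    have : ∀ z, statDist E z * ((F z - 1) * (H z - 1)) = statDist E z * (F z * H z)
        - statDist E z * F z - statDist E z * H z + statDist E z := fun z => by ring
    rw [hprod, sum_congr rfl fun z _ => this z, sum_add_distrib, sum_sub_distrib,
      sum_sub_distrib, hF, hrev, sum_statDist E hm]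
    ring
  rw [hcenter]
  unfold chiSq
  simp only [statDist_swap E hE]
  refine sum_sq_le_sum_mul_sum_of_sq_le_mul univ
    (fun z _ => mul_nonneg (hπ z).le (sq_nonneg _))
    (fun z _ => mul_nonneg (hπ z).le (sq_nonneg _)) (fun z _ => le_of_eq ?_)
  ring

lemma chiSq_le_of_le (hl : ∀ x, ¬ E x x) (hE : ∀ x, dout E x = din E x)
    (hconn : (SimpleGraph.fromRel E).Connected) (hm : 0 < numEdges E)
    (hpos : ∀ x, 0 < dout E x) {a : ℝ} (ha : 0 < a) {t : ℕ}
    (ht : 64 / a * min ((numEdges E : ℝ) * Fintype.card V) ((numEdges E : ℝ) ^ 2 / a) ≤ t)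
    (x : V) : chiSq E x t ≤ a := by
  have hmR : (0 : ℝ) < numEdges E := by exact_mod_cast hm
  have : Nonempty V := hconn.nonempty
  have hn : (0 : ℝ) < Fintype.card V := by exact_mod_cast Fintype.card_pos
  have hv := chiSq_nonneg E hm hpos x t
  obtain ⟨h1, h2⟩ := chiSq_decay E hl hE hconn hm hpos x t
  have htpos : (0 : ℝ) < t := lt_of_lt_of_le (by positivity) ht
  rcases min_choice ((numEdges E : ℝ) * Fintype.card V) ((numEdges E : ℝ) ^ 2 / a) with h | h
  · rw [h, div_mul_eq_mul_div, div_le_iff₀ ha] at ht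
    refine le_of_mul_le_mul_left ?_ htpos
    have : 0 < (numEdges E : ℝ) * Fintype.card V := by positivity
    linarith
  · rw [h, div_mul_div_comm, div_le_iff₀ (by positivity)] at ht
    refine (sq_le_sq₀ hv ha.le).1 (le_of_mul_le_mul_left ?_ htpos)
    rw [sq a]
    linarith

end Reversal

/-- There is a positive constant `c2` such that for every connected Eulerian
digraph on `n` vertices and `m` directed edges and every `a > 0`, the lazy simple random walk
satisfies `t_unif(a) ≤ (c2/a)·min(m·n, m²/a)`, i.e. there is a time `t` below this bound at
which `|P^t(x,y)/π(y) − 1| ≤ a` for all vertices `x, y`. -/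
theorem eulerian_lazy_tunif_a_bound :
    ∃ c2 : ℝ, 0 < c2 ∧
      ∀ (V : Type) [Fintype V] [DecidableEq V] (E : V → V → Prop) [DecidableRel E],
        (∀ x, ¬ E x x) →
        (∀ x, dout E x = din E x) →
        (SimpleGraph.fromRel E).Connected →
        0 < numEdges E →
        ∀ a : ℝ, 0 < a →
          ∃ t : ℕ,
            (t : ℝ) ≤ c2 / a *
              min ((numEdges E : ℝ) * (Fintype.card V : ℝ)) ((numEdges E : ℝ) ^ 2 / a) ∧
            ∀ x y : V, |(lazyP E ^ t) x y / statDist E y - 1| ≤ a := by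
  refine ⟨130, by norm_num, ?_⟩
  intro V _ _ E _ hl hE hconn hm a ha
  have hpos := dout_pos_of_connected E hE hconn hl hm
  have hmR : (0 : ℝ) < numEdges E := by exact_mod_cast hm
  have : Nonempty V := hconn.nonempty
  have hn : (1 : ℝ) ≤ Fintype.card V := by exact_mod_cast Fintype.card_pos
  have hm' : 0 < numEdges (fun x y => E y x) := by rw [numEdges_swap E hE]; exact hm
  have hE' : ∀ x, dout (fun x y => E y x) x = din (fun x y => E y x) x := fun x => (hE x).symm
  have hpos' : ∀ x, 0 < dout (fun x y => E y x) x := fun x => by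
    rw [dout_swap E hE]; exact hpos x
  have hconn' : (SimpleGraph.fromRel fun x y => E y x).Connected := by
    have : SimpleGraph.fromRel (fun x y => E y x) = SimpleGraph.fromRel E := by
      ext x y
      simp only [SimpleGraph.fromRel_adj, or_comm]
    rw [this]
    exact hconn
  have reduce : ∀ t : ℕ, (∀ x, chiSq E x t ≤ a) → (∀ y, chiSq (fun x y => E y x) y t ≤ a) →
      ∀ x y, |(lazyP E ^ (2 * t)) x y / statDist E y - 1| ≤ a := by
    intro t h1 h2 x y
    refine abs_le_of_sq_le_sq ?_ ha.le
    refine (sq_lazyP_pow_two_mul_le E hl hE hm hpos t x y).trans ?_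
    rw [sq]
    exact mul_le_mul (h1 x) (h2 y) (chiSq_nonneg _ hm' hpos' y t) ha.le
  rcases le_or_gt (numEdges E : ℝ) a with hma | hma
  · refine ⟨2 * 0, by push_cast; positivity, reduce 0 (fun x => ?_) (fun y => ?_)⟩
    · exact (chiSq_zero_le E hm hpos x).trans hma
    · refine (chiSq_zero_le _ hm' hpos' y).trans ?_
      rw [numEdges_swap E hE]
      exact hma
  · set B := min ((numEdges E : ℝ) * Fintype.card V) ((numEdges E : ℝ) ^ 2 / a) with hB
    have hBa : 1 ≤ B / a := by
      rw [one_le_div ha, hB, le_min_iff]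
      refine ⟨by nlinarith, ?_⟩
      rw [le_div_iff₀ ha]
      nlinarith
    refine ⟨2 * ⌈64 / a * B⌉₊, ?_, reduce _ (fun x => ?_) (fun y => ?_)⟩
    · have h0 : 64 / a * B = 64 * (B / a) := by ring
      have h1 := (Nat.ceil_lt_add_one (a := 64 / a * B) (by rw [h0]; linarith)).le
      have h2 : 130 / a * B = 130 * (B / a) := by ring
      push_cast
      linarith
    · exact chiSq_le_of_le E hl hE hconn hm hpos ha (Nat.le_ceil _) x
    · refine chiSq_le_of_le (fun x y => E y x) (fun x => hl x) hE' hconn' hm' hpos' ha ?_ y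
      rw [numEdges_swap E hE]
      exact Nat.le_ceil _
end

section
/- There exists a positive constant C such that for every connected Eulerian digraph G on n vertices and m directed edges, the lazy simple random walk P on G satisfies, for all vertices u,v and all integers t ≥ 1: |P^t(u,v)/π(v) − 1| ≤ C·m/√t if t ≤ n², and |P^t(u,v)/π(v) − 1| ≤ C·m·n/t if t ≥ n². Moreover, if G is d-regular, then |P^t(u,v)/π(v) − 1| ≤ C·n/√t for all t ≥ 1. -/
open Finset

/-- The Dirichlet energy of a function, summed over the directed edges. -/
def energy {V : Type} [Fintype V] (E : V → V → Prop) [DecidableRel E] (g : V → ℝ) : ℝ :=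
  ∑ x, ∑ y, if E x y then (g x - g y) ^ 2 else 0

/-- A geodesic between two vertices of a connected graph, as a sequence of vertices. -/
lemma exists_geodesic {V : Type} {G : SimpleGraph V} (hG : G.Connected) (x y : V) :
    ∃ p : ℕ → V, p 0 = x ∧ p (G.dist x y) = y ∧
      (∀ i < G.dist x y, G.Adj (p i) (p (i + 1))) ∧ ∀ i ≤ G.dist x y, G.dist x (p i) = i := by
  obtain ⟨w, hw⟩ := hG.exists_walk_length_eq_dist x y
  refine ⟨w.getVert, w.getVert_zero, hw ▸ w.getVert_length,
    fun i hi => w.adj_getVert_succ (hw ▸ hi), fun i hi => ?_⟩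
  have hfst : G.dist x (w.getVert i) ≤ i := by
    have := SimpleGraph.dist_le (w.take i)
    rw [SimpleGraph.Walk.take_length] at this
    omega
  have hsnd : G.dist (w.getVert i) y ≤ w.length - i := by
    have := SimpleGraph.dist_le (w.drop i)
    rwa [SimpleGraph.Walk.drop_length] at this
  have := hG.dist_triangle (u := x) (v := w.getVert i) (w := y)
  omega

lemma dist_le_card {V : Type} [Fintype V] {G : SimpleGraph V} (hG : G.Connected) (x y : V) :
    G.dist x y ≤ Fintype.card V := by
  obtain ⟨p, -, -, -, hdist⟩ := exists_geodesic hG x y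
  have := card_le_card_of_injOn (s := range (G.dist x y))
    (t := (univ : Finset V)) p (fun i _ => mem_univ _) fun i hi j hj hij => by
      have hi := hdist i (mem_range.1 hi).le
      have hj := hdist j (mem_range.1 hj).le
      rw [← hi, ← hj, hij]
  simpa using this

section Geometry

variable {V : Type} [Fintype V] {E : V → V → Prop} [DecidableRel E]

/-- The energy counted over ordered pairs joined by an edge in either direction. -/
lemma sum_symm_energy (g : V → ℝ) :
    ∑ x, ∑ y, ((if E x y then (g x - g y) ^ 2 else 0) +
      (if E y x then (g x - g y) ^ 2 else 0)) = 2 * energy E g := by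
  simp only [sum_add_distrib]
  have : ∑ x, ∑ y, (if E y x then (g x - g y) ^ 2 else 0) = energy E g := by
    rw [sum_comm]
    refine sum_congr rfl fun x _ => sum_congr rfl fun y _ => ?_
    rw [← neg_sub, neg_sq]
  rw [this, energy, two_mul]

lemma sq_sub_le_dist_mul_energy (hG : (SimpleGraph.fromRel E).Connected) (g : V → ℝ) (x y : V) :
    (g x - g y) ^ 2 ≤ (SimpleGraph.fromRel E).dist x y * (2 * energy E g) := by
  classical
  obtain ⟨p, hp0, hpL, hadj, hdist⟩ := exists_geodesic hG x y
  set L := (SimpleGraph.fromRel E).dist x y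
  have htel : g x - g y = ∑ i ∈ range L, (g (p i) - g (p (i + 1))) := by
    rw [sum_range_sub', hp0, hpL]
  have hcs : (g x - g y) ^ 2 ≤ L * ∑ i ∈ range L, (g (p i) - g (p (i + 1))) ^ 2 := by
    rw [htel]
    simpa using sq_sum_le_card_mul_sum_sq (s := range L) (f := fun i => g (p i) - g (p (i + 1)))
  refine hcs.trans (mul_le_mul_of_nonneg_left ?_ (Nat.cast_nonneg _))
  let w : V → V → ℝ := fun a b => (if E a b then (g a - g b) ^ 2 else 0) +
      (if E b a then (g a - g b) ^ 2 else 0)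
  have hw : ∀ a b, 0 ≤ w a b := fun a b => by
    simp only [w]; split_ifs <;> positivity
  have hinj : Set.InjOn p (range L) := fun i hi j hj hij => by
    have hi := hdist i (mem_range.1 hi).le
    have hj := hdist j (mem_range.1 hj).le
    rw [← hi, ← hj, hij]
  calc ∑ i ∈ range L, (g (p i) - g (p (i + 1))) ^ 2
      ≤ ∑ i ∈ range L, ∑ b, w (p i) b := by
        refine sum_le_sum fun i hi => ?_
        refine le_trans ?_ (single_le_sum (fun b _ => hw (p i) b) (mem_univ (p (i + 1))))
        have := hadj i (mem_range.1 hi)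
        rw [SimpleGraph.fromRel_adj] at this
        simp only [w]
        rcases this.2 with h | h <;> simp only [h, if_true] <;> split_ifs <;>
          nlinarith [sq_nonneg (g (p i) - g (p (i + 1)))]
    _ = ∑ a ∈ (range L).image p, ∑ b, w a b :=
        (sum_image (f := fun a => ∑ b, w a b) hinj).symm
    _ ≤ ∑ a, ∑ b, w a b :=
        sum_le_sum_of_subset_of_nonneg (subset_univ _) fun a _ _ => sum_nonneg fun b _ => hw a b
    _ = 2 * energy E g := sum_symm_energy g

/-- A geodesic is short if the ball it crosses is small and all degrees are large. -/
lemma dist_sub_one_mul_le (hG : (SimpleGraph.fromRel E).Connected) (hloop : ∀ x, ¬ E x x) {δ : ℕ}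
    (hδ : ∀ x, δ ≤ dout E x) (x y : V) (T : Finset V)
    (hT : ∀ z, (SimpleGraph.fromRel E).dist x z < (SimpleGraph.fromRel E).dist x y → z ∈ T) :
    ((SimpleGraph.fromRel E).dist x y - 1) * δ ≤ T.card * 3 := by
  classical
  obtain ⟨p, -, -, -, hdist⟩ := exists_geodesic hG x y
  set G := SimpleGraph.fromRel E
  have hstep : ∀ i < G.dist x y - 1, ∀ z, E (p i) z → G.dist x z ≤ i + 1 ∧ i ≤ G.dist x z + 1 := by
    intro i hi z hz
    have hadj : G.Adj (p i) z := by
      rw [SimpleGraph.fromRel_adj]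
      exact ⟨fun h => hloop z (h ▸ hz), Or.inl hz⟩
    have hi := hdist i (by omega)
    have := hG.dist_triangle (u := x) (v := p i) (w := z)
    have := hG.dist_triangle (u := x) (v := z) (w := p i)
    have := SimpleGraph.dist_eq_one_iff_adj.2 hadj
    have := SimpleGraph.dist_eq_one_iff_adj.2 hadj.symm
    omega
  have := card_mul_le_card_mul (s := range (G.dist x y - 1)) (t := T) (m := δ) (n := 3)
    (fun i z => E (p i) z) ?_ ?_
  · simpa using this
  · intro i hi
    refine (hδ (p i)).trans (card_le_card fun z hz => ?_)
    simp only [mem_filter, mem_univ, true_and] at hz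
    simp only [bipartiteAbove, mem_filter]
    have hi := mem_range.1 hi
    exact ⟨hT z (by have := hstep i hi z hz; omega), hz⟩
  · intro z _
    have hsub : bipartiteBelow (fun i z => E (p i) z) (range (G.dist x y - 1)) z ⊆
        Icc (G.dist x z - 1) (G.dist x z + 1) := fun i hi => by
      simp only [bipartiteBelow, mem_filter, mem_range] at hi
      have := hstep i hi.1 z hi.2
      rw [mem_Icc]
      omega
    have := card_le_card hsub
    rw [Nat.card_Icc] at this
    omega

end Geometry

/-- The squared `L²(π)`-distance to the constant `1` of a function of `π`-mean `1`. -/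
noncomputable def excess {V : Type} [Fintype V] (E : V → V → Prop) [DecidableRel E]
    (g : V → ℝ) : ℝ :=
  (∑ x, (dout E x : ℝ) * g x ^ 2) / (numEdges E : ℝ) - 1

section Nash

variable {V : Type} [Fintype V] {E : V → V → Prop} [DecidableRel E] {g : V → ℝ}

lemma sum_dout : ∑ x, (dout E x : ℝ) = numEdges E := by
  simp [numEdges]

lemma sum_edges_fst (f : V → ℝ) :
    ∑ x, ∑ y with E x y, f x = ∑ x, (dout E x : ℝ) * f x := by
  simp [dout]

lemma sum_edges_snd (heul : ∀ x, dout E x = din E x) (f : V → ℝ) :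
    ∑ x, ∑ y with E x y, f y = ∑ x, (dout E x : ℝ) * f x := by
  simp_rw [sum_filter]
  rw [sum_comm]
  simp_rw [← sum_filter, heul]
  simp [din]

lemma energy_nonneg (g : V → ℝ) : 0 ≤ energy E g :=
  sum_nonneg fun x _ => sum_nonneg fun y _ => by split_ifs <;> positivity

lemma excess_eq_sum (hm : 0 < numEdges E) (hmass : ∑ x, (dout E x : ℝ) * g x = numEdges E) :
    excess E g = (∑ x, (dout E x : ℝ) * (g x - 1) ^ 2) / (numEdges E : ℝ) := by
  have hm' : (0 : ℝ) < numEdges E := by exact_mod_cast hm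
  have : ∑ x, (dout E x : ℝ) * (g x - 1) ^ 2 =
      ∑ x, (dout E x : ℝ) * g x ^ 2 - 2 * ∑ x, (dout E x : ℝ) * g x + ∑ x, (dout E x : ℝ) := by
    rw [mul_sum, ← sum_sub_distrib, ← sum_add_distrib]
    exact sum_congr rfl fun x _ => by ring
  rw [this, hmass, sum_dout, excess]
  field_simp
  ring

lemma excess_nonneg (hm : 0 < numEdges E) (hmass : ∑ x, (dout E x : ℝ) * g x = numEdges E) :
    0 ≤ excess E g := by
  rw [excess_eq_sum hm hmass]
  positivity

/-- The excess is at most twice the oscillation. -/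
lemma excess_le_two_mul_sub (hm : 0 < numEdges E) (hg : ∀ x, 0 ≤ g x)
    (hmass : ∑ x, (dout E x : ℝ) * g x = numEdges E) {a b : V} (ha : ∀ x, g x ≤ g a)
    (hb : ∀ x, g b ≤ g x) : excess E g ≤ 2 * (g a - g b) := by
  have hm' : (0 : ℝ) < numEdges E := by exact_mod_cast hm
  have h1a : 1 ≤ g a := by
    have : ∑ x, (dout E x : ℝ) * g x ≤ ∑ x, (dout E x : ℝ) * g a :=
      sum_le_sum fun x _ => mul_le_mul_of_nonneg_left (ha x) (Nat.cast_nonneg _)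
    rw [hmass, ← sum_mul, sum_dout] at this
    exact le_of_mul_le_mul_left (by simpa using this) hm'
  have hb1 : g b ≤ 1 := by
    have : ∑ x, (dout E x : ℝ) * g b ≤ ∑ x, (dout E x : ℝ) * g x :=
      sum_le_sum fun x _ => mul_le_mul_of_nonneg_left (hb x) (Nat.cast_nonneg _)
    rw [hmass, ← sum_mul, sum_dout] at this
    exact le_of_mul_le_mul_left (by simpa using this) hm'
  rw [excess_eq_sum hm hmass, div_le_iff₀ hm']
  calc ∑ x, (dout E x : ℝ) * (g x - 1) ^ 2
      ≤ ∑ x, ((dout E x : ℝ) * g x + dout E x) * (g a - g b) := by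
        refine sum_le_sum fun x _ => ?_
        have : (g x - 1) ^ 2 ≤ (g x + 1) * (g a - g b) := by
          have := ha x
          have := hb x
          have := hg x
          rw [← sq_abs, sq]
          refine mul_le_mul ?_ ?_ (abs_nonneg _) (by linarith) <;>
            rw [abs_le] <;> constructor <;> linarith
        have hd : (0 : ℝ) ≤ dout E x := Nat.cast_nonneg _
        nlinarith
    _ = 2 * (g a - g b) * numEdges E := by
        rw [← sum_mul, sum_add_distrib, hmass, sum_dout]
        ring

lemma excess_sq_le (hG : (SimpleGraph.fromRel E).Connected) (hm : 0 < numEdges E)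
    (hg : ∀ x, 0 ≤ g x)
    (hmass : ∑ x, (dout E x : ℝ) * g x = numEdges E) {Λ : ℝ}
    (hΛ : ∀ x y, ((SimpleGraph.fromRel E).dist x y : ℝ) ≤ Λ) :
    excess E g ^ 2 ≤ 8 * Λ * energy E g := by
  have := hG.nonempty
  obtain ⟨a, -, ha⟩ := exists_max_image univ g univ_nonempty
  obtain ⟨b, -, hb⟩ := exists_min_image univ g univ_nonempty
  have h := excess_le_two_mul_sub hm hg hmass (fun x => ha x (mem_univ x))
    (fun x => hb x (mem_univ x))
  have h0 := excess_nonneg hm hmass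
  have hpath := sq_sub_le_dist_mul_energy hG g a b
  have hA := energy_nonneg (E := E) g
  have : excess E g ^ 2 ≤ (2 * (g a - g b)) ^ 2 := pow_le_pow_left₀ h0 h 2
  nlinarith [mul_le_mul_of_nonneg_right (hΛ a b) hA]

lemma min_dout_mul_card_le {δ : ℕ} (hδ : ∀ x, δ ≤ dout E x) :
    (δ : ℝ) * Fintype.card V ≤ numEdges E := by
  have : ∑ _x : V, δ ≤ numEdges E := sum_le_sum fun x _ => hδ x
  rw [sum_const, card_univ, smul_eq_mul, mul_comm] at this
  exact_mod_cast this

/-- A Nash-type inequality for functions of mean one on a digraph of minimal degree `δ`. -/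
lemma excess_cube_le [DecidableEq V] (hloop : ∀ x, ¬ E x x)
    (hG : (SimpleGraph.fromRel E).Connected)
    (hm : 0 < numEdges E) {δ : ℕ} (hδ0 : 1 ≤ δ) (hδ : ∀ x, δ ≤ dout E x) (hg : ∀ x, 0 ≤ g x)
    (hmass : ∑ x, (dout E x : ℝ) * g x = numEdges E) :
    excess E g ^ 3 * (δ : ℝ) ^ 2 ≤ 80 * numEdges E * energy E g := by
  have := hG.nonempty
  have hm' : (0 : ℝ) < numEdges E := by exact_mod_cast hm
  have hδ' : (1 : ℝ) ≤ δ := by exact_mod_cast hδ0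
  have hA := energy_nonneg (E := E) g
  have hN0 := excess_nonneg hm hmass
  have hdδ : ∀ x, (δ : ℝ) ≤ dout E x := fun x => by exact_mod_cast hδ x
  have hcard := min_dout_mul_card_le hδ
  obtain ⟨a, -, ha⟩ := exists_max_image univ g univ_nonempty
  replace ha : ∀ x, g x ≤ g a := fun x => ha x (mem_univ x)
  set M := g a with hM
  have hNM : excess E g ≤ M - 1 := by
    rw [excess, sub_le_sub_iff_right, div_le_iff₀ hm', ← hmass, mul_sum]
    refine sum_le_sum fun x _ => ?_
    have : g x ^ 2 ≤ M * g x := by nlinarith [ha x, hg x]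
    nlinarith [hdδ x]
  rcases lt_or_ge M 2 with hM2 | hM2
  · have hdiam : ∀ x y, ((SimpleGraph.fromRel E).dist x y : ℝ) ≤ 4 * numEdges E / (δ : ℝ) ^ 2 := by
      intro x y
      have h := dist_sub_one_mul_le hG hloop hδ x y univ fun z _ => mem_univ z
      rw [card_univ] at h
      have hδn : δ ≤ Fintype.card V := (hδ a).trans (card_le_univ _)
      have h4 : (SimpleGraph.fromRel E).dist x y * δ ≤ 4 * Fintype.card V := by
        have : (SimpleGraph.fromRel E).dist x y * δ ≤
            ((SimpleGraph.fromRel E).dist x y - 1) * δ + δ := by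
          rw [← Nat.succ_mul]
          exact Nat.mul_le_mul_right _ (by omega)
        omega
      have h4' : ((SimpleGraph.fromRel E).dist x y : ℝ) * δ ≤ 4 * Fintype.card V := by
        exact_mod_cast h4
      rw [le_div_iff₀ (by positivity)]
      nlinarith
    have h := excess_sq_le hG hm hg hmass hdiam
    have h32 : excess E g ^ 3 ≤ excess E g ^ 2 :=
      pow_le_pow_of_le_one hN0 (by linarith) (by norm_num)
    have : 8 * (4 * (numEdges E : ℝ) / (δ : ℝ) ^ 2) * energy E g * (δ : ℝ) ^ 2
        = 32 * numEdges E * energy E g := by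
      field_simp
      ring
    have h5 : 0 ≤ numEdges E * energy E g := by positivity
    have := mul_le_mul_of_nonneg_right (h32.trans h) (sq_nonneg (δ : ℝ))
    linarith
  have hN3 : excess E g ^ 3 ≤ M ^ 3 := pow_le_pow_left₀ hN0 (by linarith) 3
  suffices hmain : M ^ 3 * (δ : ℝ) ^ 2 ≤ 80 * numEdges E * energy E g from
    (mul_le_mul_of_nonneg_right hN3 (sq_nonneg _)).trans hmain
  set S := univ.filter fun x => M / 2 < g x with hS
  have hScard : (S.card : ℝ) * (δ * M) ≤ 2 * numEdges E := by
    have : ∑ x ∈ S, (δ : ℝ) * (M / 2) ≤ ∑ x, (dout E x : ℝ) * g x := by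
      refine le_trans (sum_le_sum fun x hx => ?_) (sum_le_sum_of_subset_of_nonneg (subset_univ S)
        fun x _ _ => mul_nonneg (Nat.cast_nonneg _) (hg x))
      exact mul_le_mul (hdδ x) (mem_filter.1 hx).2.le (by linarith) (Nat.cast_nonneg _)
    rw [sum_const, nsmul_eq_mul, hmass] at this
    linarith
  have hMm : M * δ ≤ numEdges E := by
    rw [← hmass]
    refine le_trans ?_ (single_le_sum (f := fun x => (dout E x : ℝ) * g x)
      (fun x _ => mul_nonneg (Nat.cast_nonneg _) (hg x)) (mem_univ a))
    nlinarith [hdδ a]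
  rcases lt_or_ge (M * (δ : ℝ) ^ 2) (4 * numEdges E) with hsmall | hlarge
  · -- Follow a geodesic from the maximum to the closest vertex where `g` has halved.
    have hne : (univ.filter fun x => g x ≤ M / 2).Nonempty := by
      by_contra hne
      rw [not_nonempty_iff_eq_empty, filter_eq_empty_iff] at hne
      have : ∑ x, (dout E x : ℝ) * 1 < ∑ x, (dout E x : ℝ) * g x := by
        refine sum_lt_sum_of_nonempty univ_nonempty fun x hx => ?_
        have := hne hx
        have := hdδ x
        exact mul_lt_mul_of_pos_left (by linarith) (by linarith)
      simp only [mul_one] at this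
      rw [hmass, sum_dout] at this
      exact lt_irrefl _ this
    obtain ⟨b, hb, hbmin⟩ := exists_min_image _ (fun x => (SimpleGraph.fromRel E).dist a x) hne
    have hgb : g b ≤ M / 2 := (mem_filter.1 hb).2
    have hlen := dist_sub_one_mul_le hG hloop hδ a b S fun z hz => by
      rw [hS, mem_filter]
      refine ⟨mem_univ z, ?_⟩
      by_contra hcon
      exact absurd hz (not_lt.2 (hbmin z (mem_filter.2 ⟨mem_univ z, not_lt.1 hcon⟩)))
    have hpath := sq_sub_le_dist_mul_energy hG g a b
    set L := (SimpleGraph.fromRel E).dist a b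
    have hL : (L : ℝ) * δ ≤ S.card * 3 + δ := by
      have : L * δ ≤ (L - 1) * δ + δ := by
        rw [← Nat.succ_mul]
        exact Nat.mul_le_mul_right _ (by omega)
      exact_mod_cast this.trans (Nat.add_le_add_right hlen δ)
    have hLM : (L : ℝ) * (M * (δ : ℝ) ^ 2) ≤ 10 * numEdges E := by
      have : (L : ℝ) * δ * (δ * M) ≤ (S.card * 3 + δ) * (δ * M) :=
        mul_le_mul_of_nonneg_right hL (by positivity)
      nlinarith
    have hsq : (M / 2) ^ 2 ≤ L * (2 * energy E g) :=
      (pow_le_pow_left₀ (by linarith) (by linarith) 2).trans hpath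
    calc M ^ 3 * (δ : ℝ) ^ 2 = 4 * (M * (δ : ℝ) ^ 2) * (M / 2) ^ 2 := by ring
      _ ≤ 4 * (M * (δ : ℝ) ^ 2) * (L * (2 * energy E g)) :=
          mul_le_mul_of_nonneg_left hsq (by positivity)
      _ = 8 * energy E g * (L * (M * (δ : ℝ) ^ 2)) := by ring
      _ ≤ 8 * energy E g * (10 * numEdges E) := mul_le_mul_of_nonneg_left hLM (by positivity)
      _ = 80 * numEdges E * energy E g := by ring
  · -- At least half of the out-neighbours of the maximum lie below `M / 2`.
    have hS2 : (S.card : ℝ) ≤ δ / 2 := by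
      have hpos : (0 : ℝ) < δ * M := by positivity
      refine le_of_mul_le_mul_right ?_ hpos
      nlinarith
    set D := univ.filter fun y => E a y
    have hDS : (δ : ℝ) / 2 ≤ ((D \ S).card : ℝ) := by
      have h1 : D.card ≤ (D \ S).card + S.card := by
        have := card_le_card_sdiff_add_card (s := D) (t := S)
        omega
      have h2 : (D.card : ℝ) ≤ (D \ S).card + S.card := by exact_mod_cast h1
      have h3 : (δ : ℝ) ≤ D.card := hdδ a
      linarith
    have hen : (D \ S).card * (M / 2) ^ 2 ≤ energy E g := by
      calc (D \ S).card * (M / 2) ^ 2 = ∑ y ∈ D \ S, (M / 2) ^ 2 := by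
            rw [sum_const, nsmul_eq_mul]
        _ ≤ ∑ y ∈ D \ S, if E a y then (g a - g y) ^ 2 else 0 := by
            refine sum_le_sum fun y hy => ?_
            rw [mem_sdiff, mem_filter, mem_filter] at hy
            rw [if_pos hy.1.2]
            have : g y ≤ M / 2 := by
              by_contra hcon
              exact hy.2 ⟨mem_univ y, not_le.1 hcon⟩
            exact pow_le_pow_left₀ (by linarith) (by linarith) 2
        _ ≤ ∑ y, if E a y then (g a - g y) ^ 2 else 0 :=
            sum_le_sum_of_subset_of_nonneg (subset_univ _) fun y _ _ => by
              split_ifs <;> positivity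
        _ ≤ energy E g :=
            single_le_sum (f := fun x => ∑ y, if E x y then (g x - g y) ^ 2 else 0)
              (fun x _ => sum_nonneg fun y _ => by split_ifs <;> positivity) (mem_univ a)
    have hen' : δ / 2 * (M / 2) ^ 2 ≤ energy E g :=
      (mul_le_mul_of_nonneg_right hDS (sq_nonneg _)).trans hen
    calc M ^ 3 * (δ : ℝ) ^ 2 = 8 * (M * δ) * (δ / 2 * (M / 2) ^ 2) := by ring
      _ ≤ 8 * numEdges E * energy E g :=
          mul_le_mul (by linarith) hen' (by positivity) (by positivity)
      _ ≤ 80 * numEdges E * energy E g := by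
          have : 0 ≤ numEdges E * energy E g := by positivity
          linarith

end Nash

section Dynamics

variable {V : Type} [Fintype V] [DecidableEq V] {E : V → V → Prop} [DecidableRel E]

open Matrix in
lemma dout_mul_lazyP_mulVec (hloop : ∀ x, ¬ E x x) (g : V → ℝ) (x : V) :
    (dout E x : ℝ) * (lazyP E *ᵥ g) x = ∑ y with E x y, (g x + g y) / 2 := by
  have hterm : ∀ y, (dout E x : ℝ) * (lazyP E x y * g y) =
      (if x = y then (dout E x : ℝ) * g y / 2 else 0) + if E x y then g y / 2 else 0 := by
    intro y
    rw [lazyP]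
    by_cases hxy : x = y
    · subst hxy
      simp only [hloop x, if_true, if_false]
      ring
    · by_cases hE : E x y
      · have : (dout E x : ℝ) ≠ 0 := by
          have : 0 < dout E x := card_pos.2 ⟨y, by simpa using hE⟩
          positivity
        simp only [hxy, hE, if_true, if_false]
        field_simp
        ring
      · simp [hxy, hE]
  rw [mulVec, dotProduct, mul_sum, sum_congr rfl fun y _ => hterm y, sum_add_distrib, sum_ite_eq,
    if_pos (mem_univ x), ← sum_filter]
  simp only [add_div, sum_add_distrib, sum_const, nsmul_eq_mul]
  rw [dout]
  ring

open Matrix in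
lemma sum_dout_mul_lazyP_mulVec (hloop : ∀ x, ¬ E x x) (heul : ∀ x, dout E x = din E x)
    (g : V → ℝ) : ∑ x, (dout E x : ℝ) * (lazyP E *ᵥ g) x = ∑ x, (dout E x : ℝ) * g x := by
  simp_rw [dout_mul_lazyP_mulVec hloop, add_div, sum_add_distrib]
  rw [sum_edges_fst (fun x => g x / 2), sum_edges_snd heul (fun x => g x / 2), ← sum_add_distrib]
  exact sum_congr rfl fun x _ => by ring

open Matrix in
/-- One step of the lazy walk decreases the `L²` norm by a quarter of the energy. -/
lemma sum_dout_mul_lazyP_mulVec_sq_le (hloop : ∀ x, ¬ E x x) (heul : ∀ x, dout E x = din E x)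
    (hδ : ∀ x, 1 ≤ dout E x) (g : V → ℝ) :
    ∑ x, (dout E x : ℝ) * (lazyP E *ᵥ g) x ^ 2 ≤
      ∑ x, (dout E x : ℝ) * g x ^ 2 - energy E g / 4 := by
  have hpt : ∀ x, (dout E x : ℝ) * (lazyP E *ᵥ g) x ^ 2 ≤
      ∑ y with E x y, ((g x + g y) / 2) ^ 2 := by
    intro x
    have hd : (0 : ℝ) < dout E x := by exact_mod_cast hδ x
    refine le_of_mul_le_mul_left ?_ hd
    calc (dout E x : ℝ) * (dout E x * (lazyP E *ᵥ g) x ^ 2)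
        = (∑ y with E x y, (g x + g y) / 2) ^ 2 := by
          rw [← dout_mul_lazyP_mulVec hloop]; ring
      _ ≤ _ := sq_sum_le_card_mul_sum_sq
  refine (sum_le_sum fun x _ => hpt x).trans (le_of_eq ?_)
  have hsplit : ∀ x y, ((g x + g y) / 2) ^ 2 = g x ^ 2 / 2 + g y ^ 2 / 2 - (g x - g y) ^ 2 / 4 :=
    fun x y => by ring
  simp_rw [hsplit, sum_sub_distrib, sum_add_distrib]
  rw [sum_edges_fst (fun x => g x ^ 2 / 2), sum_edges_snd heul (fun x => g x ^ 2 / 2),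
    ← sum_add_distrib, energy, sum_div]
  congr 1
  · exact sum_congr rfl fun x _ => by ring
  · exact sum_congr rfl fun x _ => by rw [← sum_filter, sum_div]

open Matrix in
lemma excess_lazyP_mulVec_le (hloop : ∀ x, ¬ E x x) (heul : ∀ x, dout E x = din E x)
    (hδ : ∀ x, 1 ≤ dout E x) (hm : 0 < numEdges E) (g : V → ℝ) :
    excess E (lazyP E *ᵥ g) ≤ excess E g - energy E g / (4 * numEdges E) := by
  have hm' : (0 : ℝ) < numEdges E := by exact_mod_cast hm
  have h := div_le_div_of_nonneg_right (sum_dout_mul_lazyP_mulVec_sq_le hloop heul hδ g) hm'.le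
  rw [sub_div, div_div] at h
  rw [excess, excess]
  linarith

lemma lazyP_nonneg (x y : V) : 0 ≤ lazyP E x y := by
  rw [lazyP]
  split_ifs <;> positivity

/-- The density with respect to `π` of the lazy walk at time `r`, as a function of its start. -/
noncomputable def density (E : V → V → Prop) [DecidableRel E] (v : V) (r : ℕ) (w : V) : ℝ :=
  (lazyP E ^ r) w v / statDist E v

open Matrix in
lemma density_succ (v : V) (r : ℕ) : density E v (r + 1) = lazyP E *ᵥ density E v r := by
  ext w
  rw [density, pow_succ', mul_apply, mulVec, dotProduct, sum_div]
  exact sum_congr rfl fun y _ => by rw [density, mul_div_assoc]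

lemma density_nonneg (v : V) (r : ℕ) : ∀ w, 0 ≤ density E v r w := by
  induction r with
  | zero =>
    intro w
    rw [density, pow_zero, Matrix.one_apply, statDist]
    split_ifs <;> positivity
  | succ r ih =>
    intro w
    rw [density_succ]
    exact sum_nonneg fun y _ => mul_nonneg (lazyP_nonneg w y) (ih y)

lemma sum_dout_mul_density (hloop : ∀ x, ¬ E x x) (heul : ∀ x, dout E x = din E x)
    (hδ : ∀ x, 1 ≤ dout E x) (v : V) (r : ℕ) :
    ∑ w, (dout E w : ℝ) * density E v r w = numEdges E := by
  induction r with
  | zero =>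
    have hd : (0 : ℝ) < dout E v := by exact_mod_cast hδ v
    rw [sum_eq_single v]
    · simp only [density, pow_zero, Matrix.one_apply, if_true, statDist]
      field_simp
    · intro w _ hw
      simp [density, hw]
    · simp
  | succ r ih => rw [density_succ, sum_dout_mul_lazyP_mulVec hloop heul, ih]

lemma excess_density_zero_le {δ : ℕ} (hδ0 : 1 ≤ δ) (hδ : ∀ x, δ ≤ dout E x)
    (hm : 0 < numEdges E) (v : V) : excess E (density E v 0) ≤ numEdges E / δ := by
  have hm' : (0 : ℝ) < numEdges E := by exact_mod_cast hm
  have hδ' : (0 : ℝ) < δ := by exact_mod_cast hδ0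
  have hdδ : (δ : ℝ) ≤ dout E v := by exact_mod_cast hδ v
  have hd : (0 : ℝ) < dout E v := hδ'.trans_le hdδ
  have : excess E (density E v 0) = numEdges E / dout E v - 1 := by
    rw [excess, sum_eq_single v]
    · simp only [density, pow_zero, Matrix.one_apply, if_true, statDist]
      field_simp
    · intro w _ hw
      simp [density, hw]
    · simp
  have := div_le_div_of_nonneg_left hm'.le hδ' hdδ
  linarith

end Dynamics

lemma mul_succ_le_one_of_recurrence {z : ℕ → ℝ} (hz : ∀ s, 0 ≤ z s) (h0 : z 0 ≤ 1)
    (hstep : ∀ s, z (s + 1) * (1 + z s) ≤ z s) (s : ℕ) : z s * (s + 1) ≤ 1 := by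
  induction s with
  | zero => simpa using h0
  | succ s ih =>
    have h := hz s
    have h1 := hz (s + 1)
    have h2 := hstep s
    push_cast
    have hpos : 0 < 1 + z s := by linarith
    refine le_of_mul_le_mul_right ?_ hpos
    have hs : (0 : ℝ) ≤ (s : ℝ) + 1 + 1 := by positivity
    nlinarith [mul_le_mul_of_nonneg_right h2 hs]

lemma mul_succ_le_of_quadratic_decay {a : ℕ → ℝ} {B : ℝ} (hB : 0 < B) (ha : ∀ s, 0 ≤ a s)
    (h0 : a 0 ≤ B) (hstep : ∀ s, a (s + 1) ≤ a s - a s ^ 2 / B) (s : ℕ) :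
    a s * (s + 1) ≤ B := by
  have h := mul_succ_le_one_of_recurrence (z := fun s => a s / B)
    (fun s => div_nonneg (ha s) hB.le) ((div_le_one hB).2 h0) (fun s => ?_) s
  · rw [div_mul_eq_mul_div, div_le_one hB] at h
    exact h
  · have hz : 0 ≤ a s / B := div_nonneg (ha s) hB.le
    have : a (s + 1) / B ≤ a s / B * (1 - a s / B) := by
      have := div_le_div_of_nonneg_right (hstep s) hB.le
      refine this.trans (le_of_eq ?_)
      field_simp
    nlinarith [pow_nonneg hz 3, mul_le_mul_of_nonneg_right this (by linarith : 0 ≤ 1 + a s / B)]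

lemma sq_mul_succ_le_of_cubic_decay {a : ℕ → ℝ} {B : ℝ} (hB : 0 < B) (ha : ∀ s, 0 ≤ a s)
    (h0 : a 0 ≤ B) (hstep : ∀ s, a (s + 1) ≤ a s - a s ^ 3 / B ^ 2) (s : ℕ) :
    a s ^ 2 * (s + 1) ≤ B ^ 2 := by
  have hB2 : 0 < B ^ 2 := by positivity
  have hanti : ∀ s, a s ≤ B := by
    intro s
    induction s with
    | zero => exact h0
    | succ s ih =>
      have : 0 ≤ a s ^ 3 / B ^ 2 := div_nonneg (pow_nonneg (ha s) 3) hB2.le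
      linarith [hstep s]
  have h := mul_succ_le_one_of_recurrence (z := fun s => (a s / B) ^ 2)
    (fun s => sq_nonneg _) (pow_le_one₀ (div_nonneg (ha 0) hB.le) ((div_le_one hB).2 h0))
    (fun s => ?_) s
  · rw [div_pow, div_mul_eq_mul_div, div_le_one hB2] at h
    exact h
  · have hz : 0 ≤ a s / B := div_nonneg (ha s) hB.le
    have hz1 : a s / B ≤ 1 := (div_le_one hB).2 (hanti s)
    have hle : a (s + 1) / B ≤ a s / B * (1 - (a s / B) ^ 2) := by
      have := div_le_div_of_nonneg_right (hstep s) hB.le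
      refine this.trans (le_of_eq ?_)
      field_simp
    have hsq := pow_le_pow_left₀ (div_nonneg (ha (s + 1)) hB.le) hle 2
    set x := a s / B
    have hx2 : x ^ 2 ≤ 1 := pow_le_one₀ hz hz1
    calc (a (s + 1) / B) ^ 2 * (1 + x ^ 2)
        ≤ (x * (1 - x ^ 2)) ^ 2 * (1 + x ^ 2) := mul_le_mul_of_nonneg_right hsq (by positivity)
      _ = x ^ 2 * ((1 - x ^ 2) * (1 - (x ^ 2) ^ 2)) := by ring
      _ ≤ x ^ 2 * 1 := by
          refine mul_le_mul_of_nonneg_left ?_ (sq_nonneg x)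
          exact mul_le_one₀ (by linarith [sq_nonneg x]) (by nlinarith [sq_nonneg x])
            (by nlinarith [sq_nonneg x])
      _ = x ^ 2 := mul_one _

section Decay

variable {V : Type} [Fintype V] [DecidableEq V] {E : V → V → Prop} [DecidableRel E]

lemma excess_density_mul_succ_le (hloop : ∀ x, ¬ E x x) (heul : ∀ x, dout E x = din E x)
    (hG : (SimpleGraph.fromRel E).Connected) (hm : 0 < numEdges E) (hδ : ∀ x, 1 ≤ dout E x)
    (v : V) (s : ℕ) :
    excess E (density E v s) * (s + 1) ≤ 32 * numEdges E * Fintype.card V := by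
  have := hG.nonempty
  have hm' : (0 : ℝ) < numEdges E := by exact_mod_cast hm
  have hn : (1 : ℝ) ≤ Fintype.card V := by exact_mod_cast Fintype.card_pos
  refine mul_succ_le_of_quadratic_decay (a := fun s => excess E (density E v s)) (by positivity)
    (fun s => excess_nonneg hm (sum_dout_mul_density hloop heul hδ v s)) ?_ (fun s => ?_) s
  · refine (excess_density_zero_le le_rfl hδ hm v).trans ?_
    rw [Nat.cast_one, div_one]
    nlinarith
  · rw [density_succ]
    refine (excess_lazyP_mulVec_le hloop heul hδ hm _).trans (sub_le_sub_left ?_ _)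
    have h := excess_sq_le hG hm (density_nonneg v s) (sum_dout_mul_density hloop heul hδ v s)
      (Λ := Fintype.card V) fun x y => by exact_mod_cast dist_le_card hG x y
    rw [div_le_div_iff₀ (by positivity) (by positivity)]
    nlinarith [mul_le_mul_of_nonneg_right h hm'.le]

lemma excess_density_sq_mul_succ_le (hloop : ∀ x, ¬ E x x) (heul : ∀ x, dout E x = din E x)
    (hG : (SimpleGraph.fromRel E).Connected) (hm : 0 < numEdges E) {δ : ℕ} (hδ0 : 1 ≤ δ)
    (hδ : ∀ x, δ ≤ dout E x) (v : V) (s : ℕ) :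
    excess E (density E v s) ^ 2 * (s + 1) ≤ (20 * (numEdges E / δ)) ^ 2 := by
  have hm' : (0 : ℝ) < numEdges E := by exact_mod_cast hm
  have hδ' : (0 : ℝ) < δ := by exact_mod_cast hδ0
  have hδ1 : ∀ x, 1 ≤ dout E x := fun x => hδ0.trans (hδ x)
  have hK : (0 : ℝ) < numEdges E / δ := by positivity
  have hmass := sum_dout_mul_density hloop heul hδ1 v
  refine sq_mul_succ_le_of_cubic_decay (a := fun s => excess E (density E v s)) (by positivity)
    (fun s => excess_nonneg hm (hmass s)) ?_ (fun s => ?_) s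
  · exact (excess_density_zero_le hδ0 hδ hm v).trans (by linarith)
  · rw [density_succ]
    refine (excess_lazyP_mulVec_le hloop heul hδ1 hm _).trans (sub_le_sub_left ?_ _)
    have h := excess_cube_le hloop hG hm hδ0 hδ (density_nonneg v s) (hmass s)
    have hA := energy_nonneg (E := E) (density E v s)
    calc excess E (density E v s) ^ 3 / (20 * (numEdges E / δ)) ^ 2
        = excess E (density E v s) ^ 3 * (δ : ℝ) ^ 2 / (400 * (numEdges E : ℝ) ^ 2) := by
          field_simp
          norm_num
      _ ≤ 80 * numEdges E * energy E (density E v s) / (400 * (numEdges E : ℝ) ^ 2) :=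
          div_le_div_of_nonneg_right h (by positivity)
      _ = energy E (density E v s) / (5 * numEdges E) := by
          field_simp
          ring
      _ ≤ energy E (density E v s) / (4 * numEdges E) :=
          div_le_div_of_nonneg_left hA (by positivity) (by linarith)

end Decay

section Reversal

variable {V : Type} [Fintype V] {E : V → V → Prop} [DecidableRel E]

lemma dout_reverse (heul : ∀ x, dout E x = din E x) (x : V) :
    dout (fun a b => E b a) x = dout E x :=
  (heul x).symm

lemma numEdges_reverse (heul : ∀ x, dout E x = din E x) :
    numEdges (fun a b => E b a) = numEdges E :=
  sum_congr rfl fun x _ => dout_reverse heul x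

lemma excess_reverse (heul : ∀ x, dout E x = din E x) (g : V → ℝ) :
    excess (fun a b => E b a) g = excess E g := by
  simp only [excess, numEdges_reverse heul, dout_reverse heul]

lemma fromRel_reverse {V : Type} (E : V → V → Prop) :
    SimpleGraph.fromRel (fun a b => E b a) = SimpleGraph.fromRel E := by
  ext a b
  simp only [SimpleGraph.fromRel_adj, or_comm]

open Matrix in
/-- The lazy walk on the reversed digraph is the time reversal of the lazy walk. -/
lemma dout_mul_lazyP_pow [DecidableEq V] (heul : ∀ x, dout E x = din E x)
    (hδ : ∀ x, 1 ≤ dout E x) (s : ℕ) (x y : V) :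
    (dout E x : ℝ) * (lazyP E ^ s) x y = (lazyP (fun a b => E b a) ^ s) y x * dout E y := by
  have hone : SemiconjBy (diagonal fun x => (dout E x : ℝ)) (lazyP E)
      (lazyP fun a b => E b a)ᵀ := by
    ext a b
    have ha : (dout E a : ℝ) ≠ 0 := by have := hδ a; positivity
    have hb : (dout E b : ℝ) ≠ 0 := by have := hδ b; positivity
    rw [diagonal_mul, mul_diagonal, transpose_apply, lazyP, lazyP, dout_reverse heul]
    by_cases hab : a = b
    · subst hab
      simp only [if_true]
      ring
    · by_cases hE : E a b
      · simp only [hab, Ne.symm hab, hE, if_true, if_false]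
        field_simp
      · simp [hab, Ne.symm hab, hE]
  have h := congrFun (congrFun (hone.pow_right s) x) y
  rwa [diagonal_mul, mul_diagonal, ← transpose_pow, transpose_apply] at h

end Reversal

section Main

variable {V : Type} [Fintype V] [DecidableEq V] {E : V → V → Prop} [DecidableRel E]

/-- Splitting the time interval bounds the relative density by the excesses of the walk and of
its reversal. -/
lemma abs_density_sub_one_le (hloop : ∀ x, ¬ E x x) (heul : ∀ x, dout E x = din E x)
    (hm : 0 < numEdges E) (hδ : ∀ x, 1 ≤ dout E x) (u v : V) (s r : ℕ) {β : ℝ}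
    (hs : excess (fun a b => E b a) (density (fun a b => E b a) u s) ≤ β)
    (hr : excess E (density E v r) ≤ β) :
    |(lazyP E ^ (s + r)) u v / statDist E v - 1| ≤ β := by
  have hm' : (0 : ℝ) < numEdges E := by exact_mod_cast hm
  have hmassr := sum_dout_mul_density hloop heul hδ v r
  have hmasss : ∑ w, (dout E w : ℝ) * density (fun a b => E b a) u s w = numEdges E := by
    have := sum_dout_mul_density (E := fun a b => E b a) hloop (fun x => (heul x).symm)
      (fun x => (dout_reverse heul x).symm ▸ hδ x) u s
    simpa only [dout_reverse heul, numEdges_reverse heul] using this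
  rw [excess_reverse heul, excess_eq_sum hm hmasss, div_le_iff₀ hm'] at hs
  rw [excess_eq_sum hm hmassr, div_le_iff₀ hm'] at hr
  set f := density (fun a b => E b a) u s with hf
  set h := density E v r with hh
  have hid : (lazyP E ^ (s + r)) u v / statDist E v - 1 =
      (∑ w, (dout E w : ℝ) * ((f w - 1) * (h w - 1))) / numEdges E := by
    have hexp : ∑ w, (dout E w : ℝ) * ((f w - 1) * (h w - 1)) =
        ∑ w, (dout E w : ℝ) * (f w * h w) - ∑ w, (dout E w : ℝ) * f w -
          ∑ w, (dout E w : ℝ) * h w + ∑ w, (dout E w : ℝ) := by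
      rw [← sum_sub_distrib, ← sum_sub_distrib, ← sum_add_distrib]
      exact sum_congr rfl fun w _ => by ring
    have hprod : ∑ w, (dout E w : ℝ) * (f w * h w) =
        numEdges E * ((lazyP E ^ (s + r)) u v / statDist E v) := by
      rw [pow_add, Matrix.mul_apply, sum_div, mul_sum]
      refine sum_congr rfl fun w _ => ?_
      have hrev := dout_mul_lazyP_pow heul hδ s u w
      have hu : (dout E u : ℝ) ≠ 0 := by have := hδ u; positivity
      have hfw : (dout E w : ℝ) * f w = numEdges E * (lazyP E ^ s) u w := by
        rw [hf, density, statDist, dout_reverse heul, numEdges_reverse heul]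
        field_simp
        linarith
      rw [← mul_assoc, hfw, hh, density]
      ring
    rw [hexp, hprod, hmasss, hmassr, sum_dout]
    field_simp
    ring
  rw [hid, abs_div, abs_of_pos hm', div_le_iff₀ hm']
  refine (abs_sum_le_sum_abs _ _).trans ?_
  calc ∑ w, |(dout E w : ℝ) * ((f w - 1) * (h w - 1))|
      ≤ ∑ w, ((dout E w : ℝ) * (f w - 1) ^ 2 + (dout E w : ℝ) * (h w - 1) ^ 2) / 2 := by
        refine sum_le_sum fun w _ => ?_
        rw [abs_mul, Nat.abs_cast, ← mul_add, mul_div_assoc, abs_mul]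
        refine mul_le_mul_of_nonneg_left ?_ (Nat.cast_nonneg _)
        nlinarith [two_mul_le_add_sq |f w - 1| |h w - 1|, sq_abs (f w - 1), sq_abs (h w - 1)]
    _ ≤ β * numEdges E := by
        rw [← sum_div, sum_add_distrib]
        linarith

lemma exists_balanced_split (t : ℕ) :
    ∃ s r, t = s + r ∧ (t : ℝ) ≤ 2 * (s + 1) ∧ (t : ℝ) ≤ 2 * (r + 1) := by
  have hs : t ≤ 2 * (t / 2 + 1) := by omega
  have hr : t ≤ 2 * (t - t / 2 + 1) := by omega
  exact ⟨t / 2, t - t / 2, by omega, by exact_mod_cast hs, by exact_mod_cast hr⟩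

lemma abs_density_sub_one_le_div (hloop : ∀ x, ¬ E x x) (heul : ∀ x, dout E x = din E x)
    (hG : (SimpleGraph.fromRel E).Connected) (hm : 0 < numEdges E) (hδ : ∀ x, 1 ≤ dout E x)
    (u v : V) {t : ℕ} (ht : 1 ≤ t) :
    |(lazyP E ^ t) u v / statDist E v - 1| ≤ 64 * numEdges E * Fintype.card V / t := by
  have ht' : (0 : ℝ) < t := by exact_mod_cast ht
  have key : ∀ (a : ℝ) (s : ℕ), (t : ℝ) ≤ 2 * (s + 1) →
      a * (s + 1) ≤ 32 * numEdges E * Fintype.card V →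
      a ≤ 64 * numEdges E * Fintype.card V / t := by
    intro a s hs h
    rw [← le_div_iff₀ (by positivity)] at h
    refine h.trans ?_
    rw [div_le_div_iff₀ (by positivity) ht']
    have : (0 : ℝ) ≤ 32 * numEdges E * Fintype.card V := by positivity
    nlinarith
  obtain ⟨s, r, hsr, hs, hr⟩ := exists_balanced_split t
  have hrev := excess_density_mul_succ_le (E := fun a b => E b a) hloop
    (fun x => (heul x).symm) ((fromRel_reverse E).symm ▸ hG) ((numEdges_reverse heul).symm ▸ hm)
    (fun x => (dout_reverse heul x).symm ▸ hδ x) u s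
  rw [numEdges_reverse heul] at hrev
  exact hsr ▸ abs_density_sub_one_le hloop heul hm hδ u v s r (hsr ▸ key _ s hs hrev)
    (hsr ▸ key _ r hr (excess_density_mul_succ_le hloop heul hG hm hδ v r))

lemma abs_density_sub_one_le_div_sqrt (hloop : ∀ x, ¬ E x x) (heul : ∀ x, dout E x = din E x)
    (hG : (SimpleGraph.fromRel E).Connected) (hm : 0 < numEdges E) {δ : ℕ} (hδ0 : 1 ≤ δ)
    (hδ : ∀ x, δ ≤ dout E x) (u v : V) {t : ℕ} (ht : 1 ≤ t) :
    |(lazyP E ^ t) u v / statDist E v - 1| ≤ 64 * (numEdges E / δ) / Real.sqrt t := by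
  have ht' : (0 : ℝ) < t := by exact_mod_cast ht
  have key : ∀ (a : ℝ) (s : ℕ), (t : ℝ) ≤ 2 * (s + 1) →
      a ^ 2 * (s + 1) ≤ (20 * (numEdges E / δ)) ^ 2 → a ≤ 64 * (numEdges E / δ) / Real.sqrt t := by
    intro a s hs h
    rw [le_div_iff₀ (Real.sqrt_pos.2 ht')]
    refine le_of_abs_le (abs_le_of_sq_le_sq ?_ (by positivity))
    rw [mul_pow, Real.sq_sqrt ht'.le]
    nlinarith [mul_le_mul_of_nonneg_left hs (sq_nonneg a), sq_nonneg ((numEdges E : ℝ) / δ)]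
  obtain ⟨s, r, hsr, hs, hr⟩ := exists_balanced_split t
  have hrev := excess_density_sq_mul_succ_le (E := fun a b => E b a) hloop
    (fun x => (heul x).symm) ((fromRel_reverse E).symm ▸ hG) ((numEdges_reverse heul).symm ▸ hm)
    hδ0 (fun x => (dout_reverse heul x).symm ▸ hδ x) u s
  rw [numEdges_reverse heul] at hrev
  exact hsr ▸ abs_density_sub_one_le hloop heul hm (fun x => hδ0.trans (hδ x)) u v s r
    (hsr ▸ key _ s hs hrev)
    (hsr ▸ key _ r hr (excess_density_sq_mul_succ_le hloop heul hG hm hδ0 hδ v r))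

end Main

lemma one_le_dout {V : Type} [Fintype V] {E : V → V → Prop} [DecidableRel E]
    (hloop : ∀ x, ¬ E x x) (heul : ∀ x, dout E x = din E x)
    (hG : (SimpleGraph.fromRel E).Connected) (hm : 0 < numEdges E) (x : V) : 1 ≤ dout E x := by
  obtain ⟨a, -, ha⟩ := exists_ne_zero_of_sum_ne_zero hm.ne'
  obtain ⟨b, hb⟩ := card_pos.1 (Nat.pos_of_ne_zero ha)
  have hab : E a b := (mem_filter.1 hb).2
  have : Nontrivial V := ⟨a, b, fun h => hloop b (h ▸ hab)⟩
  obtain ⟨y, hy⟩ := hG.preconnected.exists_adj_of_nontrivial x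
  rw [SimpleGraph.fromRel_adj] at hy
  rcases hy.2 with h | h
  · exact card_pos.2 ⟨y, by simpa using h⟩
  · rw [heul]
    exact card_pos.2 ⟨y, by simpa using h⟩

/-- There is a positive constant `C` such that for every connected Eulerian
digraph on `n` vertices and `m` directed edges, the lazy simple random walk `P` satisfies for
all vertices `u, v` and integers `t ≥ 1`: `|P^t(u,v)/π(v) − 1| ≤ C·m/√t` if `t ≤ n²`, and
`|P^t(u,v)/π(v) − 1| ≤ C·m·n/t` if `t ≥ n²`; moreover if `G` is `d`-regular, then
`|P^t(u,v)/π(v) − 1| ≤ C·n/√t` for all `t ≥ 1`. -/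
theorem eulerian_lazy_short_time_bounds :
    ∃ C : ℝ, 0 < C ∧
      ∀ (V : Type) [Fintype V] [DecidableEq V] (E : V → V → Prop) [DecidableRel E],
        (∀ x, ¬ E x x) →
        (∀ x, dout E x = din E x) →
        (SimpleGraph.fromRel E).Connected →
        0 < numEdges E →
        ∀ (u v : V) (t : ℕ), 1 ≤ t →
          ((t ≤ Fintype.card V ^ 2 →
              |(lazyP E ^ t) u v / statDist E v - 1| ≤
                C * (numEdges E : ℝ) / Real.sqrt (t : ℝ)) ∧
           (Fintype.card V ^ 2 ≤ t →
              |(lazyP E ^ t) u v / statDist E v - 1| ≤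
                C * (numEdges E : ℝ) * (Fintype.card V : ℝ) / (t : ℝ)) ∧
           ((∃ d : ℕ, ∀ x, dout E x = d ∧ din E x = d) →
              |(lazyP E ^ t) u v / statDist E v - 1| ≤
                C * (Fintype.card V : ℝ) / Real.sqrt (t : ℝ))) := by
  refine ⟨64, by norm_num, ?_⟩
  intro V _ _ E _ hloop heul hG hm u v t ht
  have hδ := one_le_dout hloop heul hG hm
  refine ⟨fun _ => ?_, fun _ => abs_density_sub_one_le_div hloop heul hG hm hδ u v ht, ?_⟩
  · simpa using abs_density_sub_one_le_div_sqrt hloop heul hG hm le_rfl hδ u v ht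
  · rintro ⟨d, hd⟩
    have hd0 : 1 ≤ d := (hd u).1 ▸ hδ u
    have h := abs_density_sub_one_le_div_sqrt hloop heul hG hm hd0 (fun x => (hd x).1.ge) u v ht
    have hcard : (numEdges E : ℝ) / d = Fintype.card V := by
      have : (d : ℝ) ≠ 0 := by positivity
      rw [numEdges, sum_congr rfl fun x _ => (hd x).1, sum_const, card_univ, smul_eq_mul]
      push_cast
      field_simp
    rwa [hcard] at h
end
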